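/- arXiv:1806.09332 — 2 statements merged into one kernel-verified Lean document; each statement's English description precedes it below -/
import Mathlib

section
/- For all j, k, l ∈ ℤ²\{0}: ⟨H_{e_j}, ẽ_k ⊗ ẽ_l⟩ = √2·π²·(j·l^⊥/|l|² + j·k^⊥/|k|²)·(δ_{j,k+l} - δ_{j,-k-l}) if j ∈ ℤ²₊, and = √2·π²·i·(j·l^⊥/|l|² + j·k^⊥/|k|²)·(δ_{j,k+l} + δ_{j,-k-l}) if j ∈ ℤ²₋. -/
open scoped BigOperators
open MeasureTheory

noncomputable section

/-- `|k|² = k₁² + k₂²` for a lattice point `k ∈ ℤ²`, as a real number. -/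
def nsq (k : ℤ × ℤ) : ℝ := (k.1 : ℝ) ^ 2 + (k.2 : ℝ) ^ 2

/-- `k^⊥ = (k₂, -k₁)`. -/
def perp (k : ℤ × ℤ) : ℤ × ℤ := (k.2, -k.1)

/-- Euclidean inner product of two lattice points, as a real number. -/
def dotR (a b : ℤ × ℤ) : ℝ := (a.1 : ℝ) * (b.1 : ℝ) + (a.2 : ℝ) * (b.2 : ℝ)

/-- `C_{k,l} = (k^⊥ · l)/|k|²`. -/
def Ckl (k l : ℤ × ℤ) : ℝ := dotR (perp k) l / nsq k

/-- `D_{k,l} = (k · l)/|k|²`. -/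
def Dkl (k l : ℤ × ℤ) : ℝ := dotR k l / nsq k

/-- `Λ_N = {k ∈ ℤ²\{0} : |k| ≤ N}` as a finite set. -/
def ΛN (N : ℤ) : Finset (ℤ × ℤ) :=
  (Finset.Icc (-N, -N) (N, N)).filter (fun k => k ≠ 0 ∧ k.1 ^ 2 + k.2 ^ 2 ≤ N ^ 2)

/-- `ℤ²₊ = {k ≠ 0 : k₁ > 0 or (k₁ = 0 and k₂ > 0)}`. -/
def Zplus (k : ℤ × ℤ) : Prop := 0 < k.1 ∨ (k.1 = 0 ∧ 0 < k.2)

instance : DecidablePred Zplus := fun k => by unfold Zplus; infer_instance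

/-- The real trigonometric basis `e_k` on the torus `𝕋² = ℝ²/ℤ²`, viewed as a
periodic function on `ℝ²`: `√2 cos(2πk·x)` for `k ∈ ℤ²₊` and `√2 sin(2πk·x)` otherwise. -/
def eR (k : ℤ × ℤ) (x : ℝ × ℝ) : ℝ :=
  if Zplus k then Real.sqrt 2 * Real.cos (2 * Real.pi * ((k.1 : ℝ) * x.1 + (k.2 : ℝ) * x.2))
  else Real.sqrt 2 * Real.sin (2 * Real.pi * ((k.1 : ℝ) * x.1 + (k.2 : ℝ) * x.2))

/-- The divergence-free vector field `σ_k(x) = (1/√2)(k^⊥/|k|²) e_k(x)`. -/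
def sigmaVF (k : ℤ × ℤ) (x : ℝ × ℝ) : ℝ × ℝ :=
  ((Real.sqrt 2)⁻¹ * ((k.2 : ℝ) / nsq k) * eR k x,
   (Real.sqrt 2)⁻¹ * (-(k.1 : ℝ) / nsq k) * eR k x)

/-- The complex exponential `ẽ_k(x) = e^{2πik·x}` on the torus. -/
def ec (k : ℤ × ℤ) (x : ℝ × ℝ) : ℂ :=
  Complex.exp (2 * Real.pi * Complex.I * ((k.1 : ℂ) * (x.1 : ℂ) + (k.2 : ℂ) * (x.2 : ℂ)))

/-- The fundamental domain (unit square) of the torus `𝕋² = ℝ²/ℤ²`. -/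
def Q2 : Set (ℝ × ℝ) := Set.Ioo (0 : ℝ) 1 ×ˢ Set.Ioo (0 : ℝ) 1

/-- The kernel `H_{e_j}(x,y) = π (e_{-j}(x) - e_{-j}(y)) j·K(x-y)` built from the
Biot–Savart kernel `K` on `𝕋²`. -/
def HeJ (K : ℝ × ℝ → ℝ × ℝ) (j : ℤ × ℤ) (x y : ℝ × ℝ) : ℝ :=
  Real.pi * (eR (-j) x - eR (-j) y) *
    ((j.1 : ℝ) * (K (x.1 - y.1, x.2 - y.2)).1 + (j.2 : ℝ) * (K (x.1 - y.1, x.2 - y.2)).2)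

/-- The Fourier coefficient `⟨H_{e_j}, ẽ_k ⊗ ẽ_l⟩ = ∫∫ H_{e_j}(x,y) ẽ_k(x) ẽ_l(y) dx dy`. -/
def HcInt (K : ℝ × ℝ → ℝ × ℝ) (j k l : ℤ × ℤ) : ℂ :=
  ∫ x in Q2, ∫ y in Q2, ((HeJ K j x y : ℝ) : ℂ) * ec k x * ec l y

/-- The hypotheses characterizing the Biot–Savart kernel `K` on `𝕋²`: periodicity,
local integrability, and Fourier coefficients `K̂(m) = 2πi m^⊥/|m|²` (`m ≠ 0`), `K̂(0) = 0`. -/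
structure IsBiotSavart (K : ℝ × ℝ → ℝ × ℝ) : Prop where
  periodic : ∀ x : ℝ × ℝ, K (x.1 + 1, x.2) = K x ∧ K (x.1, x.2 + 1) = K x
  integrable : MeasureTheory.IntegrableOn K Q2
  coef : ∀ m : ℤ × ℤ, m ≠ 0 →
    (∫ z in Q2, ((K z).1 : ℂ) * ec (-m) z) = 2 * Real.pi * Complex.I * (m.2 : ℂ) / (nsq m : ℂ) ∧
    (∫ z in Q2, ((K z).2 : ℂ) * ec (-m) z) = 2 * Real.pi * Complex.I * (-(m.1 : ℂ)) / (nsq m : ℂ)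
  coef0 : (∫ z in Q2, (K z).1) = 0 ∧ (∫ z in Q2, (K z).2) = 0

/-- The explicit Fourier coefficient `⟨H_{e_j}, ẽ_k ⊗ ẽ_l⟩` of the nonlinear kernel
`H_{e_j}(x,y) = π(e_{-j}(x) - e_{-j}(y)) j·K(x-y)` on `𝕋²`, as computed in the paper:
`√2π²(j·l^⊥/|l|² + j·k^⊥/|k|²)` times `δ_{j,k+l} - δ_{j,-k-l}` for `j ∈ ℤ²₊`
and times `i(δ_{j,k+l} + δ_{j,-k-l})` for `j ∈ ℤ²₋`. -/
def Hcoef (j k l : ℤ × ℤ) : ℂ :=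
  ((Real.sqrt 2 * Real.pi ^ 2 : ℝ) : ℂ) *
    ((dotR j (perp l) / nsq l + dotR j (perp k) / nsq k : ℝ) : ℂ) *
    (if Zplus j then
      ((if j = k + l then (1 : ℂ) else 0) - (if j = -(k + l) then (1 : ℂ) else 0))
     else
      Complex.I * ((if j = k + l then (1 : ℂ) else 0) + (if j = -(k + l) then (1 : ℂ) else 0)))

/-- The lattice `ℤ² ⊂ ℝ²`. -/
abbrev unitLattice : AddSubgroup (ℝ × ℝ) :=
  (Submodule.span ℤ (Set.range (Module.Basis.finTwoProd ℝ))).toAddSubgroup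

instance : Countable unitLattice :=
  inferInstanceAs (Countable (Submodule.span ℤ (Set.range (Module.Basis.finTwoProd ℝ))))

/-- The half-open unit square, a fundamental domain of `ℤ²`. -/
abbrev unitSquare : Set (ℝ × ℝ) := ZSpan.fundamentalDomain (Module.Basis.finTwoProd ℝ)

theorem isAddFundamentalDomain_unitSquare :
    IsAddFundamentalDomain unitLattice unitSquare (volume : Measure (ℝ × ℝ)) :=
  ZSpan.isAddFundamentalDomain' _ _

theorem Q2_ae_eq_unitSquare : Q2 =ᵐ[volume] unitSquare := by
  have h : unitSquare = Set.Ico (0 : ℝ) 1 ×ˢ Set.Ico (0 : ℝ) 1 := by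
    ext x
    simp [unitSquare, ZSpan.mem_fundamentalDomain, Fin.forall_fin_two]
  rw [h]
  exact Measure.set_prod_ae_eq Ioo_ae_eq_Ico Ioo_ae_eq_Ico

theorem isAddFundamentalDomain_sub_preimage_unitSquare (x : ℝ × ℝ) :
    IsAddFundamentalDomain unitLattice ((fun y => x - y) ⁻¹' unitSquare)
      (volume : Measure (ℝ × ℝ)) := by
  refine isAddFundamentalDomain_unitSquare.preimage_of_equiv (e := fun g => -g)
    (Measure.measurePreserving_sub_left volume x).quasiMeasurePreserving neg_involutive.bijective ?_
  intro g y
  simp only [AddSubgroup.vadd_def, vadd_eq_add, NegMemClass.coe_neg]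
  abel

theorem Function.Periodic.unitLattice_vadd_eq {E : Type*} {f : ℝ × ℝ → E}
    (h₁ : Function.Periodic f (1, 0)) (h₂ : Function.Periodic f (0, 1))
    (g : unitLattice) (z : ℝ × ℝ) : f (g +ᵥ z) = f z := by
  have key : ∀ p ∈ Submodule.span ℤ (Set.range (Module.Basis.finTwoProd ℝ)),
      Function.Periodic f p := by
    intro p hp
    induction hp using Submodule.span_induction with
    | mem p hp =>
      obtain ⟨i, rfl⟩ := hp
      fin_cases i
      · simpa using h₁
      · simpa using h₂
    | zero => intro x; simp
    | add p q _ _ hp hq => exact hp.add_period hq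
    | smul n p _ hp => exact hp.zsmul n
  rw [AddSubgroup.vadd_def, vadd_eq_add, add_comm]
  exact key g g.2 z

theorem integrableOn_Q2_comp_sub {f : ℝ × ℝ → ℂ}
    (h₁ : Function.Periodic f (1, 0)) (h₂ : Function.Periodic f (0, 1))
    (hf : IntegrableOn f Q2) (x : ℝ × ℝ) : IntegrableOn (fun y => f (x - y)) Q2 := by
  have hp := Measure.measurePreserving_sub_left (volume : Measure (ℝ × ℝ)) x
  have he : MeasurableEmbedding (fun y : ℝ × ℝ => x - y) :=
    (MeasurableEquiv.subLeft x).measurableEmbedding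
  rw [integrableOn_congr_set_ae Q2_ae_eq_unitSquare] at hf ⊢
  rw [isAddFundamentalDomain_unitSquare.integrableOn_iff
    (isAddFundamentalDomain_sub_preimage_unitSquare x)]
  · exact (hp.integrableOn_comp_preimage he).2 hf
  · exact Function.Periodic.unitLattice_vadd_eq (h₁.const_sub x) (h₂.const_sub x)

theorem setIntegral_Q2_comp_sub {f : ℝ × ℝ → ℂ}
    (h₁ : Function.Periodic f (1, 0)) (h₂ : Function.Periodic f (0, 1)) (x : ℝ × ℝ) :
    ∫ y in Q2, f (x - y) = ∫ z in Q2, f z := by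
  have hp := Measure.measurePreserving_sub_left (volume : Measure (ℝ × ℝ)) x
  have he : MeasurableEmbedding (fun y : ℝ × ℝ => x - y) :=
    (MeasurableEquiv.subLeft x).measurableEmbedding
  rw [setIntegral_congr_set Q2_ae_eq_unitSquare, setIntegral_congr_set Q2_ae_eq_unitSquare,
    ← hp.setIntegral_preimage_emb he f]
  exact isAddFundamentalDomain_unitSquare.setIntegral_eq
    (isAddFundamentalDomain_sub_preimage_unitSquare x)
    (Function.Periodic.unitLattice_vadd_eq (h₁.const_sub x) (h₂.const_sub x))

theorem ec_add (a b : ℤ × ℤ) (x : ℝ × ℝ) : ec (a + b) x = ec a x * ec b x := by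
  simp only [ec, ← Complex.exp_add, Prod.fst_add, Prod.snd_add]
  congr 1; push_cast; ring

theorem ec_neg_sub (a : ℤ × ℤ) (x y : ℝ × ℝ) : ec (-a) (x - y) = ec (-a) x * ec a y := by
  simp only [ec, ← Complex.exp_add, Prod.fst_neg, Prod.snd_neg, Prod.fst_sub, Prod.snd_sub]
  congr 1; push_cast; ring

theorem ec_zero (x : ℝ × ℝ) : ec 0 x = 1 := by simp [ec]

theorem continuous_ec (a : ℤ × ℤ) : Continuous (ec a) := by
  unfold ec; fun_prop

theorem norm_ec (a : ℤ × ℤ) (x : ℝ × ℝ) : ‖ec a x‖ = 1 := by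
  have h : ec a x =
      Complex.exp (((2 * Real.pi * (a.1 * x.1 + a.2 * x.2) : ℝ) : ℂ) * Complex.I) := by
    unfold ec; congr 1; push_cast; ring
  rw [h, Complex.norm_exp_ofReal_mul_I]

theorem ec_periodic_fst (a : ℤ × ℤ) : Function.Periodic (ec a) (1, 0) := fun x =>
  Complex.exp_eq_exp_iff_exists_int.2 ⟨a.1, by
    simp only [Prod.fst_add, Prod.snd_add]; push_cast; ring⟩

theorem ec_periodic_snd (a : ℤ × ℤ) : Function.Periodic (ec a) (0, 1) := fun x =>
  Complex.exp_eq_exp_iff_exists_int.2 ⟨a.2, by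
    simp only [Prod.fst_add, Prod.snd_add]; push_cast; ring⟩

theorem setIntegral_exp_two_pi_int (n : ℤ) :
    ∫ t in Set.Ioo (0 : ℝ) 1, Complex.exp (2 * Real.pi * Complex.I * n * t) =
      if n = 0 then 1 else 0 := by
  rw [← integral_Ioc_eq_integral_Ioo, ← intervalIntegral.integral_of_le zero_le_one]
  split_ifs with h
  · simp [h]
  · have hc : 2 * Real.pi * Complex.I * n ≠ 0 := by
      simp [h, Real.pi_ne_zero, Complex.I_ne_zero]
    rw [integral_exp_mul_complex hc]
    have := Complex.exp_int_mul_two_pi_mul_I n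
    rw [show 2 * Real.pi * Complex.I * n * ((1 : ℝ) : ℂ) = n * (2 * Real.pi * Complex.I) by
      push_cast; ring, this]
    simp

theorem setIntegral_ec (a : ℤ × ℤ) : ∫ x in Q2, ec a x = if a = 0 then 1 else 0 := by
  have h : ∀ x : ℝ × ℝ, ec a x = Complex.exp (2 * Real.pi * Complex.I * a.1 * x.1) *
      Complex.exp (2 * Real.pi * Complex.I * a.2 * x.2) := fun x => by
    rw [ec, ← Complex.exp_add]; congr 1; ring
  simp only [h]
  rw [Q2, Measure.volume_eq_prod, setIntegral_prod_mul
    (fun t : ℝ => Complex.exp (2 * Real.pi * Complex.I * a.1 * t))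
    (fun t : ℝ => Complex.exp (2 * Real.pi * Complex.I * a.2 * t)),
    setIntegral_exp_two_pi_int, setIntegral_exp_two_pi_int]
  by_cases h₁ : a.1 = 0 <;> by_cases h₂ : a.2 = 0 <;> simp [h₁, h₂, Prod.ext_iff]

theorem integrableOn_Q2_mul_ec {f : ℝ × ℝ → ℂ} (hf : IntegrableOn f Q2) (a : ℤ × ℤ) :
    IntegrableOn (fun z => f z * ec a z) Q2 :=
  Integrable.mul_bdd (c := 1) hf (continuous_ec a).aestronglyMeasurable
    (Filter.Eventually.of_forall fun x => (norm_ec a x).le)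

theorem integrableOn_Q2_comp_sub_mul_ec {f : ℝ × ℝ → ℂ}
    (h₁ : Function.Periodic f (1, 0)) (h₂ : Function.Periodic f (0, 1))
    (hf : IntegrableOn f Q2) (x : ℝ × ℝ) (a : ℤ × ℤ) :
    IntegrableOn (fun y => f (x - y) * ec a y) Q2 :=
  integrableOn_Q2_mul_ec (integrableOn_Q2_comp_sub h₁ h₂ hf x) a

/-- Convolving a periodic function with a character multiplies it by a Fourier coefficient. -/
theorem setIntegral_comp_sub_mul_ec {f : ℝ × ℝ → ℂ}
    (h₁ : Function.Periodic f (1, 0)) (h₂ : Function.Periodic f (0, 1))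
    (x : ℝ × ℝ) (a : ℤ × ℤ) :
    ∫ y in Q2, f (x - y) * ec a y = ec a x * ∫ z in Q2, f z * ec (-a) z := by
  have h := setIntegral_Q2_comp_sub (h₁.mul (ec_periodic_fst (-a)))
    (h₂.mul (ec_periodic_snd (-a))) x
  simp only [Pi.mul_apply] at h
  rw [← h, ← integral_const_mul]
  congr 1 with y
  have h : ec a x * ec (-a) x = 1 := by rw [← ec_add, add_neg_cancel, ec_zero]
  rw [ec_neg_sub]
  linear_combination (-(f (x - y) * ec a y)) * h

theorem setIntegral_commutator_ec {f : ℝ × ℝ → ℂ}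
    (h₁ : Function.Periodic f (1, 0)) (h₂ : Function.Periodic f (0, 1))
    (hf : IntegrableOn f Q2) (x : ℝ × ℝ) (a k l : ℤ × ℤ) :
    ∫ y in Q2, (ec a x - ec a y) * f (x - y) * ec k x * ec l y =
      ec (a + k + l) x *
        ((∫ z in Q2, f z * ec (-l) z) - ∫ z in Q2, f z * ec (-(a + l)) z) := by
  have hi := fun b => integrableOn_Q2_comp_sub_mul_ec h₁ h₂ hf x b
  have h : ∀ y, (ec a x - ec a y) * f (x - y) * ec k x * ec l y =
      ec (a + k) x * (f (x - y) * ec l y) - ec k x * (f (x - y) * ec (a + l) y) := fun y => by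
    rw [ec_add, ec_add]; ring
  simp only [h]
  rw [integral_sub ((hi _).const_mul _) ((hi _).const_mul _), integral_const_mul,
    integral_const_mul, setIntegral_comp_sub_mul_ec h₁ h₂, setIntegral_comp_sub_mul_ec h₁ h₂]
  simp only [ec_add]; ring

theorem integrableOn_commutator_ec {f : ℝ × ℝ → ℂ}
    (h₁ : Function.Periodic f (1, 0)) (h₂ : Function.Periodic f (0, 1))
    (hf : IntegrableOn f Q2) (x : ℝ × ℝ) (a k l : ℤ × ℤ) :
    IntegrableOn (fun y => (ec a x - ec a y) * f (x - y) * ec k x * ec l y) Q2 := by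
  have hi := fun b => integrableOn_Q2_comp_sub_mul_ec h₁ h₂ hf x b
  have h : ∀ y, (ec a x - ec a y) * f (x - y) * ec k x * ec l y =
      ec (a + k) x * (f (x - y) * ec l y) - ec k x * (f (x - y) * ec (a + l) y) := fun y => by
    rw [ec_add, ec_add]; ring
  simp only [h]
  exact ((hi _).const_mul _).sub ((hi _).const_mul _)

theorem not_zplus_neg {j : ℤ × ℤ} (h : Zplus j) : ¬ Zplus (-j) := by
  simp only [Zplus, Prod.fst_neg, Prod.snd_neg] at *; omega

theorem zplus_neg {j : ℤ × ℤ} (hj : j ≠ 0) (h : ¬ Zplus j) : Zplus (-j) := by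
  have : ¬ (j.1 = 0 ∧ j.2 = 0) := fun h => hj (Prod.ext h.1 h.2)
  simp only [Zplus, Prod.fst_neg, Prod.snd_neg] at *; omega

theorem eR_neg_eq_of_zplus {j : ℤ × ℤ} (h : Zplus j) (x : ℝ × ℝ) :
    (eR (-j) x : ℂ) = Real.sqrt 2 * Complex.I / 2 * (ec j x - ec (-j) x) := by
  rw [eR, if_neg (not_zplus_neg h)]
  push_cast
  rw [Complex.sin, ec, ec]
  simp only [Prod.fst_neg, Prod.snd_neg, Int.cast_neg]
  ring_nf

theorem eR_neg_eq_of_not_zplus {j : ℤ × ℤ} (hj : j ≠ 0) (h : ¬ Zplus j) (x : ℝ × ℝ) :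
    (eR (-j) x : ℂ) = Real.sqrt 2 / 2 * (ec j x + ec (-j) x) := by
  rw [eR, if_pos (zplus_neg hj h)]
  push_cast
  rw [Complex.cos, ec, ec]
  simp only [Prod.fst_neg, Prod.snd_neg, Int.cast_neg]
  ring_nf

/-- `j · K`, as a complex-valued function. -/
def dotKernel (K : ℝ × ℝ → ℝ × ℝ) (j : ℤ × ℤ) (z : ℝ × ℝ) : ℂ :=
  (j.1 : ℂ) * ((K z).1 : ℂ) + (j.2 : ℂ) * ((K z).2 : ℂ)

theorem IsBiotSavart.dotKernel_periodic_fst {K : ℝ × ℝ → ℝ × ℝ} (hK : IsBiotSavart K)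
    (j : ℤ × ℤ) : Function.Periodic (dotKernel K j) (1, 0) := fun x => by
  have h : K (x + (1, 0)) = K x := by
    rw [← (hK.periodic x).1]; congr 1; ext <;> simp
  rw [dotKernel, dotKernel, h]

theorem IsBiotSavart.dotKernel_periodic_snd {K : ℝ × ℝ → ℝ × ℝ} (hK : IsBiotSavart K)
    (j : ℤ × ℤ) : Function.Periodic (dotKernel K j) (0, 1) := fun x => by
  have h : K (x + (0, 1)) = K x := by
    rw [← (hK.periodic x).2]; congr 1; ext <;> simp
  rw [dotKernel, dotKernel, h]

theorem IsBiotSavart.integrableOn_dotKernel {K : ℝ × ℝ → ℝ × ℝ} (hK : IsBiotSavart K)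
    (j : ℤ × ℤ) : IntegrableOn (dotKernel K j) Q2 :=
  (hK.integrable.fst.ofReal.const_mul _).add (hK.integrable.snd.ofReal.const_mul _)

theorem IsBiotSavart.setIntegral_dotKernel {K : ℝ × ℝ → ℝ × ℝ} (hK : IsBiotSavart K)
    (j : ℤ × ℤ) {m : ℤ × ℤ} (hm : m ≠ 0) :
    ∫ z in Q2, dotKernel K j z * ec (-m) z =
      2 * Real.pi * Complex.I * ((dotR j (perp m) / nsq m : ℝ) : ℂ) := by
  have h₁ : IntegrableOn (fun z => ((K z).1 : ℂ) * ec (-m) z) Q2 :=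
    integrableOn_Q2_mul_ec hK.integrable.fst.ofReal _
  have h₂ : IntegrableOn (fun z => ((K z).2 : ℂ) * ec (-m) z) Q2 :=
    integrableOn_Q2_mul_ec hK.integrable.snd.ofReal _
  have h : ∀ z, dotKernel K j z * ec (-m) z =
      j.1 * (((K z).1 : ℂ) * ec (-m) z) + j.2 * (((K z).2 : ℂ) * ec (-m) z) := fun z => by
    rw [dotKernel]; ring
  simp only [h]
  rw [integral_add (h₁.const_mul _) (h₂.const_mul _), integral_const_mul, integral_const_mul,
    (hK.coef m hm).1, (hK.coef m hm).2]
  simp only [dotR, perp]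
  push_cast
  ring

/-- The complex exponential counterpart of the Fourier coefficients of `HeJ`. -/
theorem IsBiotSavart.integral_commutator {K : ℝ × ℝ → ℝ × ℝ} (hK : IsBiotSavart K)
    (j a k l : ℤ × ℤ) (hk : k ≠ 0) (hl : l ≠ 0) :
    ∫ x in Q2, ∫ y in Q2, (ec a x - ec a y) * dotKernel K j (x - y) * ec k x * ec l y =
      (if a = -(k + l) then 1 else 0) * (2 * Real.pi * Complex.I *
        ((dotR j (perp l) / nsq l + dotR j (perp k) / nsq k : ℝ) : ℂ)) := by
  simp only [setIntegral_commutator_ec (hK.dotKernel_periodic_fst j) (hK.dotKernel_periodic_snd j)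
    (hK.integrableOn_dotKernel j)]
  rw [integral_mul_const, setIntegral_ec]
  have hiff : a + k + l = 0 ↔ a = -(k + l) := by rw [add_assoc, add_eq_zero_iff_eq_neg]
  simp only [hiff]
  split_ifs with h
  · have hal : a + l = -k := by rw [h]; abel
    rw [hal, hK.setIntegral_dotKernel j hl, hK.setIntegral_dotKernel j (neg_ne_zero.2 hk)]
    simp only [dotR, perp, nsq, Prod.fst_neg, Prod.snd_neg]
    push_cast
    ring
  · simp

theorem IsBiotSavart.HcInt_eq {K : ℝ × ℝ → ℝ × ℝ} (hK : IsBiotSavart K) {j : ℤ × ℤ} (c s : ℂ)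
    (hc : ∀ x, (eR (-j) x : ℂ) = c * (ec j x + s * ec (-j) x))
    (k l : ℤ × ℤ) (hk : k ≠ 0) (hl : l ≠ 0) :
    HcInt K j k l = 2 * Real.pi ^ 2 * Complex.I * c *
      ((dotR j (perp l) / nsq l + dotR j (perp k) / nsq k : ℝ) : ℂ) *
      ((if j = -(k + l) then 1 else 0) + s * (if j = k + l then 1 else 0)) := by
  have hp₁ := hK.dotKernel_periodic_fst j
  have hp₂ := hK.dotKernel_periodic_snd j
  have hi := hK.integrableOn_dotKernel j
  have h : ∀ x y, ((HeJ K j x y : ℝ) : ℂ) * ec k x * ec l y =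
      (Real.pi * c) * ((ec j x - ec j y) * dotKernel K j (x - y) * ec k x * ec l y) +
      (Real.pi * c * s) *
        ((ec (-j) x - ec (-j) y) * dotKernel K j (x - y) * ec k x * ec l y) := fun x y => by
    have hxy : x - y = (x.1 - y.1, x.2 - y.2) := rfl
    rw [HeJ, hxy]
    push_cast
    rw [hc, hc, dotKernel]
    ring
  have hinner : ∀ a, IntegrableOn (fun x => ∫ y in Q2,
      (ec a x - ec a y) * dotKernel K j (x - y) * ec k x * ec l y) Q2 := fun a => by
    simp only [setIntegral_commutator_ec hp₁ hp₂ hi]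
    refine Integrable.mul_const ?_ _
    have h1 : IntegrableOn (fun _ => (1 : ℂ)) Q2 := by
      rw [integrableOn_congr_set_ae Q2_ae_eq_unitSquare]
      exact integrableOn_const
        (ZSpan.fundamentalDomain_isBounded _).measure_lt_top.ne
    simpa [IntegrableOn] using integrableOn_Q2_mul_ec h1 (a + k + l)
  have hj : -j = -(k + l) ↔ j = k + l := neg_inj
  simp only [HcInt, h]
  simp only [integral_add ((integrableOn_commutator_ec hp₁ hp₂ hi _ _ _ _).const_mul _)
    ((integrableOn_commutator_ec hp₁ hp₂ hi _ _ _ _).const_mul _), integral_const_mul]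
  rw [integral_add ((hinner _).const_mul _) ((hinner _).const_mul _), integral_const_mul,
    integral_const_mul, hK.integral_commutator j j k l hk hl,
    hK.integral_commutator j (-j) k l hk hl]
  simp only [hj]
  ring

theorem Hcoef_formula
    (K : ℝ × ℝ → ℝ × ℝ) (hK : IsBiotSavart K) (j : ℤ × ℤ) (hj : j ≠ 0)
    (hHint : MeasureTheory.IntegrableOn
      (fun p : (ℝ × ℝ) × (ℝ × ℝ) => HeJ K j p.1 p.2) (Q2 ×ˢ Q2)) :
    ∀ k l : ℤ × ℤ, k ≠ 0 → l ≠ 0 → HcInt K j k l = Hcoef j k l := by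
  intro k l hk hl
  rw [Hcoef]
  by_cases h : Zplus j
  · rw [hK.HcInt_eq (Real.sqrt 2 * Complex.I / 2) (-1)
      (fun x => by rw [eR_neg_eq_of_zplus h]; ring) k l hk hl, if_pos h, Complex.ofReal_mul, Complex.ofReal_pow]
    linear_combination (Real.sqrt 2 * Real.pi ^ 2 *
      ((dotR j (perp l) / nsq l + dotR j (perp k) / nsq k : ℝ) : ℂ) *
      ((if j = -(k + l) then 1 else 0) - (if j = k + l then 1 else 0))) * Complex.I_sq
  · rw [hK.HcInt_eq (Real.sqrt 2 / 2) 1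
      (fun x => by rw [eR_neg_eq_of_not_zplus hj h]; ring) k l hk hl, if_neg h, Complex.ofReal_mul,
      Complex.ofReal_pow]
    ring
end
end

section
/- There exists a constant C > 0 such that for every j ∈ ℤ²\{0} with |j| ≥ 2, Σ_{k,l ∈ ℤ²\{0}} |⟨H_{e_j}, ẽ_k ⊗ ẽ_l⟩|² ≤ C |j|² log|j|. -/
open scoped BigOperators
open MeasureTheory

noncomputable section

/-- The kernel `1 / (|k|² (R + |k|²))` dominating the convolution sum; it vanishes at `k = 0`. -/
def latticeKernel (R : ℝ) (k : ℤ × ℤ) : ℝ := 1 / (nsq k * (R + nsq k))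

lemma nsq_nonneg (k : ℤ × ℤ) : 0 ≤ nsq k := by unfold nsq; positivity

lemma nsq_pos {k : ℤ × ℤ} (hk : k ≠ 0) : 0 < nsq k := by
  unfold nsq
  by_cases h : k.1 = 0
  · have h2 : k.2 ≠ 0 := fun h2 => hk (Prod.ext h h2)
    have : (k.2 : ℝ) ≠ 0 := by exact_mod_cast h2
    positivity
  · have : (k.1 : ℝ) ≠ 0 := by exact_mod_cast h
    positivity

lemma latticeKernel_nonneg {R : ℝ} (hR : 0 ≤ R) (k : ℤ × ℤ) : 0 ≤ latticeKernel R k := by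
  have := nsq_nonneg k
  unfold latticeKernel
  positivity

lemma one_div_le_log_sub_log {R x : ℝ} (hR : 0 < R) (hx : 1 ≤ x) :
    1 / ((x + 1) * (R + (x + 1) ^ 2)) ≤
      (Real.log ((x + 1) ^ 2 / (R + (x + 1) ^ 2)) - Real.log (x ^ 2 / (R + x ^ 2))) / R := by
  have hx0 : 0 < x := by linarith
  rw [← Real.log_div (by positivity) (by positivity), le_div_iff₀ hR]
  refine le_trans ?_ (Real.one_sub_inv_le_log_of_pos (by positivity))
  have : 1 - ((x + 1) ^ 2 / (R + (x + 1) ^ 2) / (x ^ 2 / (R + x ^ 2)))⁻¹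
      = R * (2 * x + 1) / ((x + 1) ^ 2 * (R + x ^ 2)) := by
    field_simp
    ring
  rw [this, div_mul_eq_mul_div, div_le_div_iff₀ (by positivity) (by positivity)]
  have h : 0 ≤ R * (x + 1) * (x * (R + x ^ 2) + (2 * x + 1) ^ 2) := by positivity
  nlinarith [h]

lemma sum_one_div_mul_add_sq_le {R : ℝ} (hR : 0 < R) (M : ℕ) :
    ∑ m ∈ Finset.range M, 1 / (((m : ℝ) + 1) * (R + ((m : ℝ) + 1) ^ 2)) ≤
      (Real.log (1 + R) + 1) / R := by
  have key : ∀ n : ℕ, ∑ m ∈ Finset.range (n + 1), 1 / (((m : ℝ) + 1) * (R + ((m : ℝ) + 1) ^ 2)) ≤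
      1 / (1 + R) + (Real.log (((n : ℝ) + 1) ^ 2 / (R + ((n : ℝ) + 1) ^ 2))
        + Real.log (1 + R)) / R := by
    intro n
    induction n with
    | zero => simp [add_comm]
    | succ n ih =>
      rw [Finset.sum_range_succ]
      have h := one_div_le_log_sub_log (x := (n : ℝ) + 1) hR (by linarith [n.cast_nonneg (α := ℝ)])
      push_cast
      refine (add_le_add ih h).trans (le_of_eq ?_)
      ring
  have hlog : 0 ≤ Real.log (1 + R) := Real.log_nonneg (by linarith)
  cases M with
  | zero => simp; positivity
  | succ n =>
    refine (key n).trans ?_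
    have h1 : Real.log (((n : ℝ) + 1) ^ 2 / (R + ((n : ℝ) + 1) ^ 2)) ≤ 0 :=
      Real.log_nonpos (by positivity) (by rw [div_le_one (by positivity)]; linarith)
    have h2 : 1 / (1 + R) ≤ 1 / R := one_div_le_one_div_of_le hR (by linarith)
    have h3 : (Real.log (((n : ℝ) + 1) ^ 2 / (R + ((n : ℝ) + 1) ^ 2)) + Real.log (1 + R)) / R
        ≤ Real.log (1 + R) / R := by gcongr; linarith
    rw [add_div (Real.log (1 + R)) 1 R]
    linarith

lemma latticeKernel_le_of_mem_box {R : ℝ} (hR : 0 < R) {m : ℕ} {k : ℤ × ℤ}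
    (hk : k ∈ Finset.box (α := ℤ × ℤ) (m + 1)) :
    latticeKernel R k ≤ 1 / (((m : ℝ) + 1) ^ 2 * (R + ((m : ℝ) + 1) ^ 2)) := by
  rw [Int.mem_box] at hk
  have h : ((m : ℝ) + 1) ^ 2 ≤ nsq k := by
    have e : ((m : ℝ) + 1) = ((max k.1.natAbs k.2.natAbs : ℕ) : ℝ) := by rw [hk]; push_cast; rfl
    have e1 : ((k.1.natAbs : ℕ) : ℝ) ^ 2 = (k.1 : ℝ) ^ 2 := by
      rw [Nat.cast_natAbs, Int.cast_abs, sq_abs]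
    have e2 : ((k.2.natAbs : ℕ) : ℝ) ^ 2 = (k.2 : ℝ) ^ 2 := by
      rw [Nat.cast_natAbs, Int.cast_abs, sq_abs]
    rw [e, nsq]
    rcases max_choice k.1.natAbs k.2.natAbs with h | h <;> rw [h]
    · rw [e1]; nlinarith [sq_nonneg (k.2 : ℝ)]
    · rw [e2]; nlinarith [sq_nonneg (k.1 : ℝ)]
  have := nsq_nonneg k
  unfold latticeKernel
  gcongr

lemma sum_latticeKernel_le {R : ℝ} (hR : 0 < R) (s : Finset (ℤ × ℤ)) :
    ∑ k ∈ s, latticeKernel R k ≤ 8 * ((Real.log (1 + R) + 1) / R) := by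
  classical
  set M : ℕ := s.sup fun k => max k.1.natAbs k.2.natAbs
  have hmaps : ∀ k ∈ s, max k.1.natAbs k.2.natAbs ∈ Finset.range (M + 1) := fun k hk =>
    Finset.mem_range_succ_iff.2 (Finset.le_sup (f := fun k : ℤ × ℤ => max k.1.natAbs k.2.natAbs) hk)
  rw [← Finset.sum_fiberwise_of_maps_to hmaps, Finset.sum_range_succ']
  have hzero : ∑ k ∈ s with max k.1.natAbs k.2.natAbs = 0, latticeKernel R k = 0 := by
    refine Finset.sum_eq_zero fun k hk => ?_
    have h := (Finset.mem_filter.1 hk).2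
    have h1 : k.1 = 0 := by omega
    have h2 : k.2 = 0 := by omega
    simp [latticeKernel, nsq, h1, h2]
  rw [hzero, add_zero]
  refine le_trans ?_ (mul_le_mul_of_nonneg_left (sum_one_div_mul_add_sq_le hR M) (by norm_num))
  rw [Finset.mul_sum]
  refine Finset.sum_le_sum fun m _ => ?_
  calc ∑ k ∈ s with max k.1.natAbs k.2.natAbs = m + 1, latticeKernel R k
      ≤ ∑ k ∈ Finset.box (α := ℤ × ℤ) (m + 1), latticeKernel R k :=
        Finset.sum_le_sum_of_subset_of_nonneg
          (fun k hk => Int.mem_box.2 (Finset.mem_filter.1 hk).2)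
          fun k _ _ => latticeKernel_nonneg hR.le k
    _ ≤ (Finset.box (α := ℤ × ℤ) (m + 1)).card •
          (1 / (((m : ℝ) + 1) ^ 2 * (R + ((m : ℝ) + 1) ^ 2))) :=
        Finset.sum_le_card_nsmul _ _ _ fun k hk => latticeKernel_le_of_mem_box hR hk
    _ = 8 * (1 / (((m : ℝ) + 1) * (R + ((m : ℝ) + 1) ^ 2))) := by
        rw [Int.card_box (by omega), nsmul_eq_mul]
        push_cast
        field_simp

lemma one_div_nsq_mul_nsq_le {k l : ℤ × ℤ} (hk : k ≠ 0) (hl : l ≠ 0) :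
    1 / (nsq k * nsq l) ≤
      3 * (latticeKernel (nsq (k + l)) k + latticeKernel (nsq (k + l)) l) := by
  have hk' := nsq_pos hk
  have hl' := nsq_pos hl
  have hj := nsq_nonneg (k + l)
  have hpar : nsq (k + l) ≤ 2 * (nsq k + nsq l) := by
    simp only [nsq, Prod.fst_add, Prod.snd_add]
    push_cast
    nlinarith [sq_nonneg ((k.1 : ℝ) - l.1), sq_nonneg ((k.2 : ℝ) - l.2)]
  have hsum : 1 / (nsq k * nsq l) =
      1 / (nsq k * (nsq k + nsq l)) + 1 / (nsq l * (nsq k + nsq l)) := by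
    field_simp
    ring
  have aux : ∀ a : ℝ, 0 < a → nsq (k + l) + a ≤ 3 * (nsq k + nsq l) →
      1 / (a * (nsq k + nsq l)) ≤ 3 * (1 / (a * (nsq (k + l) + a))) := by
    intro a ha h
    rw [mul_one_div, div_le_div_iff₀ (by positivity) (by positivity)]
    nlinarith [mul_le_mul_of_nonneg_left h ha.le]
  rw [hsum, mul_add 3]
  exact add_le_add (aux _ hk' (by linarith)) (aux _ hl' (by linarith))

lemma sq_dotR_perp_le (a b : ℤ × ℤ) : dotR a (perp b) ^ 2 ≤ nsq a * nsq b := by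
  simp only [dotR, perp, nsq]
  push_cast
  nlinarith [sq_nonneg ((a.1 : ℝ) * b.1 + a.2 * b.2)]

lemma sq_perp_coef_le {k l : ℤ × ℤ} (hk : k ≠ 0) (hl : l ≠ 0) :
    (dotR (k + l) (perp l) / nsq l + dotR (k + l) (perp k) / nsq k) ^ 2 ≤
      4 * nsq (k + l) ^ 2 * (1 / (nsq k * nsq l)) := by
  have hk' := nsq_pos hk
  have hl' := nsq_pos hl
  have hj := nsq_nonneg (k + l)
  set p := dotR (k + l) (perp k) with hp
  have hpl : dotR (k + l) (perp l) = -p := by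
    simp only [hp, dotR, perp, Prod.fst_add, Prod.snd_add]
    push_cast
    ring
  have h1 : p ^ 2 ≤ nsq (k + l) * nsq k := sq_dotR_perp_le _ _
  have h2 : p ^ 2 ≤ nsq (k + l) * nsq l := by
    have := sq_dotR_perp_le (k + l) l
    rwa [hpl, neg_sq] at this
  have h3 : (nsq l - nsq k) ^ 2 ≤ 2 * nsq (k + l) * (nsq k + nsq l) := by
    simp only [nsq, Prod.fst_add, Prod.snd_add]
    push_cast
    nlinarith [sq_nonneg (((k.1 : ℝ) + l.1) * (l.2 - k.2) - (k.2 + l.2) * (l.1 - k.1))]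
  have h4 : p ^ 2 * (nsq k + nsq l) ≤ 2 * nsq (k + l) * (nsq k * nsq l) := by
    nlinarith [mul_le_mul_of_nonneg_right h1 hl'.le, mul_le_mul_of_nonneg_right h2 hk'.le]
  have heq : (dotR (k + l) (perp l) / nsq l + p / nsq k) ^ 2 =
      p ^ 2 * (nsq l - nsq k) ^ 2 / (nsq k * nsq l) ^ 2 := by
    rw [hpl]
    field_simp
    ring
  rw [heq, mul_one_div, div_le_div_iff₀ (by positivity) (by positivity)]
  have h5 : p ^ 2 * (nsq l - nsq k) ^ 2 ≤ 4 * nsq (k + l) ^ 2 * (nsq k * nsq l) := by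
    nlinarith [mul_le_mul_of_nonneg_left h3 (sq_nonneg p),
      mul_le_mul_of_nonneg_left h4 hj]
  calc _ ≤ 4 * nsq (k + l) ^ 2 * (nsq k * nsq l) * (nsq k * nsq l) := by gcongr
    _ = _ := by ring

lemma dotR_neg_left (a b : ℤ × ℤ) : dotR (-a) b = -dotR a b := by
  simp only [dotR, Prod.fst_neg, Prod.snd_neg]
  push_cast
  ring

lemma nsq_neg (a : ℤ × ℤ) : nsq (-a) = nsq a := by
  simp [nsq]

lemma normSq_Hcoef_le {j k l : ℤ × ℤ} (hk : k ≠ 0) (hl : l ≠ 0) :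
    ‖Hcoef j k l‖ ^ 2 ≤ 96 * Real.pi ^ 4 * nsq j ^ 2 *
      ((if j = k + l then latticeKernel (nsq j) k + latticeKernel (nsq j) l else 0) +
       (if j = -(k + l) then latticeKernel (nsq j) k + latticeKernel (nsq j) l else 0)) := by
  have hphi : 0 ≤ latticeKernel (nsq j) k + latticeKernel (nsq j) l :=
    add_nonneg (latticeKernel_nonneg (nsq_nonneg j) k) (latticeKernel_nonneg (nsq_nonneg j) l)
  by_cases h : j = k + l ∨ j = -(k + l)
  · have hA : (dotR j (perp l) / nsq l + dotR j (perp k) / nsq k) ^ 2 ≤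
        12 * nsq j ^ 2 * (latticeKernel (nsq j) k + latticeKernel (nsq j) l) := by
      have h1 := sq_perp_coef_le hk hl
      have h2 := mul_le_mul_of_nonneg_left (one_div_nsq_mul_nsq_le hk hl)
        (by positivity : 0 ≤ 4 * nsq (k + l) ^ 2)
      rcases h with rfl | rfl
      · linarith
      · rw [dotR_neg_left, dotR_neg_left, nsq_neg, neg_div, neg_div, ← neg_add, neg_sq]
        linarith
    have hsq : ((if j = k + l then (1 : ℝ) else 0) + (if j = -(k + l) then (1 : ℝ) else 0)) ^ 2 ≤
        2 * ((if j = k + l then (1 : ℝ) else 0) + (if j = -(k + l) then (1 : ℝ) else 0)) := by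
      split_ifs <;> norm_num
    have hind : ‖(if Zplus j then
          ((if j = k + l then (1 : ℂ) else 0) - (if j = -(k + l) then (1 : ℂ) else 0))
        else
          Complex.I * ((if j = k + l then (1 : ℂ) else 0) +
            (if j = -(k + l) then (1 : ℂ) else 0)))‖ ≤
        (if j = k + l then (1 : ℝ) else 0) + (if j = -(k + l) then (1 : ℝ) else 0) := by
      split_ifs <;> norm_num
    rw [Hcoef, norm_mul, norm_mul, mul_pow, mul_pow, Complex.norm_real, Complex.norm_real,
      Real.norm_eq_abs, Real.norm_eq_abs, sq_abs, sq_abs, mul_pow,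
      Real.sq_sqrt (by norm_num : (0 : ℝ) ≤ 2)]
    calc _ ≤ 2 * (Real.pi ^ 2) ^ 2 *
          (12 * nsq j ^ 2 * (latticeKernel (nsq j) k + latticeKernel (nsq j) l)) *
          (2 * ((if j = k + l then (1 : ℝ) else 0) + (if j = -(k + l) then (1 : ℝ) else 0))) := by
          refine mul_le_mul (mul_le_mul_of_nonneg_left hA (by positivity)) ?_ (by positivity)
            (by positivity)
          exact (pow_le_pow_left₀ (norm_nonneg _) hind 2).trans hsq
      _ ≤ _ := by
          have : 0 ≤ Real.pi ^ 4 * nsq j ^ 2 *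
            (latticeKernel (nsq j) k + latticeKernel (nsq j) l) := by positivity
          split_ifs <;> nlinarith [this]
  · push Not at h
    simp only [Hcoef, if_neg h.1, if_neg h.2]
    simp

theorem sum_normSq_Hcoef_le :
    ∃ C : ℝ, 0 < C ∧ ∀ j : ℤ × ℤ, j ≠ 0 → 2 ≤ Real.sqrt (nsq j) →
      ∑' kl : {k : ℤ × ℤ // k ≠ 0} × {l : ℤ × ℤ // l ≠ 0},
          ‖Hcoef j kl.1.1 kl.2.1‖ ^ 2
        ≤ C * nsq j * Real.log (Real.sqrt (nsq j)) := by
  refine ⟨96 * 192 * Real.pi ^ 4, by positivity, fun j _ hj => ?_⟩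
  have hR4 : 4 ≤ nsq j := by
    have := (Real.le_sqrt' (by norm_num)).1 hj
    linarith
  have hR : 0 < nsq j := by linarith
  have hlogR : 1 ≤ Real.log (nsq j) := by
    rw [Real.le_log_iff_exp_le hR]
    linarith [Real.exp_one_lt_d9]
  have hlog : Real.log (1 + nsq j) ≤ 2 * Real.log (nsq j) := by
    rw [← Nat.cast_ofNat (R := ℝ), ← Real.log_pow]
    exact Real.log_le_log (by linarith) (by nlinarith)
  set B : ℝ := 8 * ((Real.log (1 + nsq j) + 1) / nsq j) with hB
  have hBle : nsq j * B ≤ 24 * Real.log (nsq j) := by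
    rw [hB]
    field_simp
    linarith
  have hpair : ∀ (i : ℤ × ℤ) (S : Finset ({k : ℤ × ℤ // k ≠ 0} × {l : ℤ × ℤ // l ≠ 0})),
      ∑ kl ∈ S, (if i = kl.1.1 + kl.2.1 then
        latticeKernel (nsq j) kl.1.1 + latticeKernel (nsq j) kl.2.1 else 0) ≤ 2 * B := by
    intro i S
    rw [← Finset.sum_filter, Finset.sum_add_distrib, two_mul]
    refine add_le_add ?_ ?_
    · rw [← Finset.sum_image (f := latticeKernel (nsq j))
        (g := fun kl : {k : ℤ × ℤ // k ≠ 0} × {l : ℤ × ℤ // l ≠ 0} => kl.1.1)]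
      · exact sum_latticeKernel_le hR _
      · intro a ha b hb hab
        have ha' := (Finset.mem_filter.1 ha).2
        have hb' := (Finset.mem_filter.1 hb).2
        have hab' : a.1.1 = b.1.1 := hab
        rw [ha', hab'] at hb'
        exact Prod.ext (Subtype.ext hab') (Subtype.ext (add_left_cancel hb'))
    · rw [← Finset.sum_image (f := latticeKernel (nsq j))
        (g := fun kl : {k : ℤ × ℤ // k ≠ 0} × {l : ℤ × ℤ // l ≠ 0} => kl.2.1)]
      · exact sum_latticeKernel_le hR _
      · intro a ha b hb hab
        have ha' := (Finset.mem_filter.1 ha).2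
        have hb' := (Finset.mem_filter.1 hb).2
        have hab' : a.2.1 = b.2.1 := hab
        rw [ha', hab'] at hb'
        exact Prod.ext (Subtype.ext (add_right_cancel hb')) (Subtype.ext hab')
  rw [Real.log_sqrt hR.le]
  refine Real.tsum_le_of_sum_le (fun _ => by positivity) fun S => ?_
  calc _ ≤ ∑ kl ∈ S, 96 * Real.pi ^ 4 * nsq j ^ 2 *
        ((if j = kl.1.1 + kl.2.1 then
            latticeKernel (nsq j) kl.1.1 + latticeKernel (nsq j) kl.2.1 else 0) +
         (if -j = kl.1.1 + kl.2.1 then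
            latticeKernel (nsq j) kl.1.1 + latticeKernel (nsq j) kl.2.1 else 0)) := by
        refine Finset.sum_le_sum fun kl _ => ?_
        simpa only [neg_eq_iff_eq_neg] using normSq_Hcoef_le (j := j) kl.1.2 kl.2.2
    _ ≤ 96 * Real.pi ^ 4 * nsq j ^ 2 * (2 * B + 2 * B) := by
        rw [← Finset.mul_sum, Finset.sum_add_distrib]
        exact mul_le_mul_of_nonneg_left (add_le_add (hpair j S) (hpair (-j) S)) (by positivity)
    _ = 384 * Real.pi ^ 4 * nsq j * (nsq j * B) := by ring
    _ ≤ 384 * Real.pi ^ 4 * nsq j * (24 * Real.log (nsq j)) := by gcongr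
    _ = _ := by ring
end
end
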